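/- Let P, Q ∈ ℝ³ be fixed points and let S = [P, Q] be the closed segment between them. Then the set {(C, D) ∈ ℝ³ × ℝ³ : the closed segment [C, D] intersects S} has Lebesgue measure zero in ℝ³ × ℝ³ ≅ ℝ⁶. -/

import Mathlib

open MeasureTheory

theorem affineSpan_triple_ne_top {E : Type*} [AddCommGroup E] [Module ℝ E]
    (h : 2 < Module.finrank ℝ E) (A B C : E) : affineSpan ℝ {A, B, C} ≠ ⊤ := by
  intro htop
  have : FiniteDimensional ℝ E := Module.finite_of_finrank_pos (by lia)
  have hle := (coplanar_triple ℝ A B C).finrank_le_two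
  rw [← direction_affineSpan, htop, AffineSubspace.direction_top, finrank_top] at hle
  lia

theorem isClosed_setOf_segment_inter_nonempty {E : Type*} [AddCommGroup E] [Module ℝ E]
    [TopologicalSpace E] [IsTopologicalAddGroup E] [ContinuousSMul ℝ E] [T2Space E]
    {K : Set E} (hK : IsCompact K) :
    IsClosed {p : E × E | (segment ℝ p.1 p.2 ∩ K).Nonempty} := by
  have : CompactSpace K := isCompact_iff_compactSpace.mp hK
  have hc : IsClosed {q : (E × E) × (unitInterval × K) |
      AffineMap.lineMap q.1.1 q.1.2 (q.2.1 : ℝ) = (q.2.2 : E)} := by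
    simp only [AffineMap.lineMap_apply_module]
    exact isClosed_eq (by fun_prop) (by fun_prop)
  convert isClosedMap_fst_of_compactSpace _ hc using 1
  ext p
  simp only [segment_eq_image_lineMap, Set.mem_ofPred_eq, Set.mem_image]
  constructor
  · rintro ⟨_, ⟨t, ht, rfl⟩, hx⟩
    exact ⟨(p, ⟨t, ht⟩, ⟨_, hx⟩), rfl, rfl⟩
  · rintro ⟨⟨p, t, x⟩, h, rfl⟩
    exact ⟨x, ⟨t, t.2, h⟩, x.2⟩

/-- If `[C, D]` meets the line `PQ` and `C` is not on it, then `D` lies in the plane `CPQ`. -/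
theorem mem_affineSpan_triple_of_mem_segment {E : Type*} [AddCommGroup E] [Module ℝ E]
    {P Q C D X : E} (hC : C ∉ affineSpan ℝ {P, Q}) (hX : X ∈ affineSpan ℝ {P, Q})
    (hXs : X ∈ segment ℝ C D) : D ∈ affineSpan ℝ {C, P, Q} := by
  rw [segment_eq_image_lineMap] at hXs
  obtain ⟨t, -, rfl⟩ := hXs
  have ht : t ≠ 0 := by
    rintro rfl
    exact hC (by simpa using hX)
  have hD : D = AffineMap.lineMap C (AffineMap.lineMap C D t) t⁻¹ := by
    simp [ht]
  rw [hD]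
  exact AffineMap.lineMap_mem _ (mem_affineSpan ℝ (by simp))
    (affineSpan_mono ℝ (Set.subset_insert _ _) hX)

theorem measure_prod_segment_inter_segment_nonempty {E : Type*} [NormedAddCommGroup E]
    [NormedSpace ℝ E] [FiniteDimensional ℝ E] [MeasurableSpace E] [BorelSpace E]
    (μ : Measure E) [μ.IsAddHaarMeasure] (h : 2 < Module.finrank ℝ E) (P Q : E) :
    (μ.prod μ) {p : E × E | (segment ℝ p.1 p.2 ∩ segment ℝ P Q).Nonempty} = 0 := by
  have hK : IsCompact (segment ℝ P Q) := by
    rw [segment_eq_image_lineMap]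
    exact isCompact_Icc.image AffineMap.lineMap_continuous
  rw [Measure.measure_prod_null (isClosed_setOf_segment_inter_nonempty hK).measurableSet]
  have hline : μ (affineSpan ℝ {P, Q}) = 0 := by
    simpa using Measure.addHaar_affineSubspace μ _ (affineSpan_triple_ne_top h P P Q)
  filter_upwards [measure_eq_zero_iff_ae_notMem.mp hline] with C hC
  refine measure_mono_null ?_
    (Measure.addHaar_affineSubspace μ _ (affineSpan_triple_ne_top h C P Q))
  rintro D ⟨X, hXs, hX⟩
  refine mem_affineSpan_triple_of_mem_segment hC ?_ hXs
  rw [segment_eq_image_lineMap] at hX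
  obtain ⟨t, -, rfl⟩ := hX
  exact AffineMap.lineMap_mem_affineSpan_pair t P Q

/-- The set of pairs `(C, D)` of points of `ℝ³` whose joining closed segment
intersects a fixed closed segment `[P, Q]` has Lebesgue measure zero in
`ℝ³ × ℝ³ ≅ ℝ⁶`. -/
theorem segment_intersection_measure_zero (P Q : EuclideanSpace ℝ (Fin 3)) :
    volume {p : EuclideanSpace ℝ (Fin 3) × EuclideanSpace ℝ (Fin 3) |
      (segment ℝ p.1 p.2 ∩ segment ℝ P Q).Nonempty} = 0 := by
  rw [Measure.volume_eq_prod]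
  exact measure_prod_segment_inter_segment_nonempty volume (by simp) P Q
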